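/- For d = 11 (m = 3), the values z± = (1 − α±/(β±+1))² with α±, β± as defined for d = 11 are exactly the two roots of the quadratic 225z² − 114z + 1, i.e., 225z±² − 114z± + 1 = 0. -/

import Mathlib

noncomputable def alphaP (d : ℝ) : ℝ := 2 + 2 * Real.sqrt ((d - 4) / (3 * (d - 2)))
noncomputable def alphaM (d : ℝ) : ℝ := 2 - 2 * Real.sqrt ((d - 4) / (3 * (d - 2)))
noncomputable def betaP (d : ℝ) : ℝ := 2 / 3 * (d - 4) + 1 / 3 * Real.sqrt (3 * (d - 2) * (d - 4))
noncomputable def betaM (d : ℝ) : ℝ := 2 / 3 * (d - 4) - 1 / 3 * Real.sqrt (3 * (d - 2) * (d - 4))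
noncomputable def zP (d : ℝ) : ℝ := (1 - alphaP d / (betaP d + 1)) ^ 2
noncomputable def zM (d : ℝ) : ℝ := (1 - alphaM d / (betaM d + 1)) ^ 2

theorem sqrt_seven_div_twentySeven : √(7 / 27 : ℝ) = √21 / 9 := by
  rw [show (7 / 27 : ℝ) = 21 / 9 ^ 2 by norm_num, Real.sqrt_div' _ (by positivity),
    Real.sqrt_sq (by norm_num)]

theorem sqrt_oneHundredEightyNine : √(189 : ℝ) = 3 * √21 := by
  rw [show (189 : ℝ) = 3 ^ 2 * 21 by norm_num, Real.sqrt_mul (by positivity),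
    Real.sqrt_sq (by norm_num)]

theorem zP_eleven : zP 11 = (57 + 12 * √21) / 225 := by
  have hs : √(21 : ℝ) ^ 2 = 21 := Real.sq_sqrt (by norm_num)
  have hα : alphaP 11 = 2 + 2 * (√21 / 9) := by
    rw [alphaP, ← sqrt_seven_div_twentySeven]; norm_num
  have hβ : betaP 11 = 14 / 3 + √21 := by
    rw [betaP, show (3 * (11 - 2) * (11 - 4) : ℝ) = 189 by norm_num, sqrt_oneHundredEightyNine]
    ring
  have h : 1 - alphaP 11 / (betaP 11 + 1) = (6 + √21) / 15 := by
    have hne : 14 / 3 + √(21 : ℝ) + 1 ≠ 0 := by positivity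
    rw [hα, hβ, sub_eq_iff_eq_add, ← sub_eq_iff_eq_add', eq_div_iff hne]
    linear_combination (-1 / 15) * hs
  rw [zP, h]
  linear_combination (1 / 225) * hs

theorem zM_eleven : zM 11 = (57 - 12 * √21) / 225 := by
  have hs : √(21 : ℝ) ^ 2 = 21 := Real.sq_sqrt (by norm_num)
  have hα : alphaM 11 = 2 - 2 * (√21 / 9) := by
    rw [alphaM, ← sqrt_seven_div_twentySeven]; norm_num
  have hβ : betaM 11 = 14 / 3 - √21 := by
    rw [betaM, show (3 * (11 - 2) * (11 - 4) : ℝ) = 189 by norm_num, sqrt_oneHundredEightyNine]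
    ring
  have h : 1 - alphaM 11 / (betaM 11 + 1) = (6 - √21) / 15 := by
    have hne : 14 / 3 - √(21 : ℝ) + 1 ≠ 0 := by
      have : √(21 : ℝ) < 5 := by rw [Real.sqrt_lt' (by norm_num)]; norm_num
      linarith
    rw [hα, hβ, sub_eq_iff_eq_add, ← sub_eq_iff_eq_add', eq_div_iff hne]
    linear_combination (-1 / 15) * hs
  rw [zM, h]
  linear_combination (1 / 225) * hs

theorem stmt18 :
    225 * zP 11 ^ 2 - 114 * zP 11 + 1 = 0 ∧ 225 * zM 11 ^ 2 - 114 * zM 11 + 1 = 0 ∧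
    zP 11 ≠ zM 11 ∧
    ∀ z : ℝ, 225 * z ^ 2 - 114 * z + 1 = 0 → z = zP 11 ∨ z = zM 11 := by
  have hs : √(21 : ℝ) ^ 2 = 21 := Real.sq_sqrt (by norm_num)
  have hpos : 0 < √(21 : ℝ) := by positivity
  rw [zP_eleven, zM_eleven]
  refine ⟨?_, ?_, ?_, fun z hz => ?_⟩
  · linear_combination (144 / 225) * hs
  · linear_combination (144 / 225) * hs
  · intro h
    linarith
  · have hfactor : (z - (57 + 12 * √21) / 225) * (z - (57 - 12 * √21) / 225) = 0 := by
      linear_combination (1 / 225) * hz - (144 / 225 ^ 2) * hs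
    exact (mul_eq_zero.mp hfactor).imp sub_eq_zero.mp sub_eq_zero.mp
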